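/- Let N ≥ 1, m > 1, 0 < p < 1 with m + p < 2, and let v : ℝ^N × (0,T) → (0,∞) be a strictly positive function of class C^∞ satisfying pointwise the pressure equation ∂_t v = (m−1) v Δv + |∇v|² + K(m,p) v^{(m+p−2)/(m−1)}, where K(m,p) = m ((m−1)/m)^{(m+p−2)/(m−1)}. Set w = Δv, R₁(v) = K(m,p) ((m+p−2)/(m−1)) v^{(p−1)/(m−1)} and R₂(v,∇v) = K(m,p) ((2−m−p)(1−p)/(m−1)²) v^{(p−m)/(m−1)} |∇v|². Then pointwise on ℝ^N × (0,T): ∂_t w ≥ (m−1) v Δw + 2m ∇v·∇w + (m−1+2/N) w² + R₁(v) w + R₂(v,∇v), and moreover R₁(v) < 0 and R₂(v,∇v) ≥ 0. -/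

import Mathlib

open MeasureTheory Set Filter
open scoped RealInnerProductSpace

noncomputable section

/-- The spatial Laplacian of a function on `EuclideanSpace ℝ (Fin N)`. -/
def lapl {N : ℕ} (f : EuclideanSpace ℝ (Fin N) → ℝ) (x : EuclideanSpace ℝ (Fin N)) : ℝ :=
  ∑ i : Fin N,
    fderiv ℝ (fun y => fderiv ℝ f y (EuclideanSpace.single i (1 : ℝ))) x
      (EuclideanSpace.single i (1 : ℝ))

/-- The derivative of `f` in the fixed direction `e`, as a function of the base point. -/
def dirDeriv {X : Type*} [NormedAddCommGroup X] [NormedSpace ℝ X] (e : X) (f : X → ℝ) : X → ℝ :=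
  fun y => fderiv ℝ f y e

section DirDeriv

variable {X : Type*} [NormedAddCommGroup X] [NormedSpace ℝ X]

theorem ContDiffOn.dirDeriv {f : X → ℝ} {U : Set X} (hU : IsOpen U)
    (hf : ContDiffOn ℝ (⊤ : ℕ∞) f U) (e : X) :
    ContDiffOn ℝ (⊤ : ℕ∞) (_root_.dirDeriv e f) U :=
  (hf.fderiv_of_isOpen hU (m := (⊤ : ℕ∞)) le_rfl).clm_apply contDiffOn_const

theorem ContDiff.dirDeriv {f : X → ℝ} (hf : ContDiff ℝ (⊤ : ℕ∞) f) (e : X) :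
    ContDiff ℝ (⊤ : ℕ∞) (_root_.dirDeriv e f) :=
  (hf.fderiv_right (m := (⊤ : ℕ∞)) le_rfl).clm_apply contDiff_const

theorem ContDiffOn.differentiableAt_of_isOpen {f : X → ℝ} {U : Set X} (hU : IsOpen U)
    (hf : ContDiffOn ℝ (⊤ : ℕ∞) f U) {z : X} (hz : z ∈ U) : DifferentiableAt ℝ f z :=
  (hf.contDiffAt (hU.mem_nhds hz)).differentiableAt (by simp)

theorem ContDiff.differentiable_of_top {f : X → ℝ} (hf : ContDiff ℝ (⊤ : ℕ∞) f) :
    Differentiable ℝ f :=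
  hf.differentiable (by simp)

theorem dirDeriv_comm_of_contDiffAt {f : X → ℝ} {z : X} (hf : ContDiffAt ℝ (⊤ : ℕ∞) f z)
    (a b : X) : dirDeriv a (dirDeriv b f) z = dirDeriv b (dirDeriv a f) z := by
  have hd : DifferentiableAt ℝ (fderiv ℝ f) z :=
    (hf.fderiv_right (m := (⊤ : ℕ∞)) le_rfl).differentiableAt (by simp)
  have h : ∀ c d : X, dirDeriv c (dirDeriv d f) z = fderiv ℝ (fderiv ℝ f) z c d := by
    intro c d
    unfold dirDeriv
    rw [fderiv_clm_apply hd (differentiableAt_const d)]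
    simp
  rw [h, h]
  exact hf.isSymmSndFDerivAt (by simpa using WithTop.coe_le_coe.2 (le_top (a := (2 : ℕ∞)))) a b

theorem dirDeriv_congr_of_eqOn {f g : X → ℝ} {U : Set X} (hU : IsOpen U) (h : EqOn f g U)
    (e : X) : EqOn (dirDeriv e f) (dirDeriv e g) U := by
  intro z hz
  unfold dirDeriv
  rw [(h.eventuallyEq_of_mem (hU.mem_nhds hz)).fderiv_eq]

theorem dirDeriv_mul {f g : X → ℝ} (hf : Differentiable ℝ f) (hg : Differentiable ℝ g) (e : X) :
    dirDeriv e (fun y => f y * g y) = fun y => f y * dirDeriv e g y + g y * dirDeriv e f y := by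
  funext y
  simp [dirDeriv, fderiv_fun_mul (hf y) (hg y)]

theorem dirDeriv_add {f g : X → ℝ} (hf : Differentiable ℝ f) (hg : Differentiable ℝ g) (e : X) :
    dirDeriv e (fun y => f y + g y) = fun y => dirDeriv e f y + dirDeriv e g y := by
  funext y
  simp [dirDeriv, fderiv_fun_add (hf y) (hg y)]

theorem dirDeriv_const_mul {f : X → ℝ} (hf : Differentiable ℝ f) (c : ℝ) (e : X) :
    dirDeriv e (fun y => c * f y) = fun y => c * dirDeriv e f y := by
  funext y
  simp [dirDeriv, fderiv_const_mul (hf y) c]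

theorem dirDeriv_sum {ι : Type*} {s : Finset ι} {f : ι → X → ℝ}
    (hf : ∀ i ∈ s, Differentiable ℝ (f i)) (e : X) :
    dirDeriv e (fun y => ∑ i ∈ s, f i y) = fun y => ∑ i ∈ s, dirDeriv e (f i) y := by
  funext y
  simp [dirDeriv, fderiv_fun_sum (fun i hi => hf i hi y)]

theorem dirDeriv_rpow {f : X → ℝ} (hf : Differentiable ℝ f) (hpos : ∀ y, 0 < f y) (a : ℝ)
    (e : X) :
    dirDeriv e (fun y => f y ^ a) = fun y => a * (f y ^ (a - 1) * dirDeriv e f y) := by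
  funext y
  unfold dirDeriv
  rw [((hf y).hasFDerivAt.rpow_const (p := a) (Or.inl (hpos y).ne')).fderiv]
  simp [mul_assoc]

end DirDeriv

section Laplacian

variable {N : ℕ}

local notation "𝔼" => EuclideanSpace ℝ (Fin N)

theorem lapl_eq_sum_dirDeriv (f : 𝔼 → ℝ) :
    lapl f = fun x => ∑ i : Fin N, dirDeriv (EuclideanSpace.single i (1 : ℝ))
      (dirDeriv (EuclideanSpace.single i (1 : ℝ)) f) x := rfl

theorem ContDiff.lapl {f : 𝔼 → ℝ} (hf : ContDiff ℝ (⊤ : ℕ∞) f) :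
    ContDiff ℝ (⊤ : ℕ∞) (_root_.lapl f) := by
  rw [lapl_eq_sum_dirDeriv]
  exact ContDiff.sum fun i _ => (hf.dirDeriv _).dirDeriv _

theorem inner_gradient_eq_sum (f g : 𝔼 → ℝ) (x : 𝔼) :
    ⟪gradient f x, gradient g x⟫ =
      ∑ i : Fin N, dirDeriv (EuclideanSpace.single i (1 : ℝ)) f x *
        dirDeriv (EuclideanSpace.single i (1 : ℝ)) g x := by
  have h : ∀ (f : 𝔼 → ℝ) (i : Fin N),
      (gradient f x) i = dirDeriv (EuclideanSpace.single i (1 : ℝ)) f x := by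
    intro f i
    have := InnerProductSpace.toDual_symm_apply (𝕜 := ℝ)
      (x := EuclideanSpace.single i (1 : ℝ)) (y := fderiv ℝ f x)
    rw [EuclideanSpace.inner_single_right] at this
    simpa [gradient, dirDeriv] using this
  simp only [PiLp.inner_apply, h]
  simp [mul_comm]

theorem lapl_add {f g : 𝔼 → ℝ} (hf : ContDiff ℝ (⊤ : ℕ∞) f) (hg : ContDiff ℝ (⊤ : ℕ∞) g) (x : 𝔼) :
    lapl (fun y => f y + g y) x = lapl f x + lapl g x := by
  simp only [lapl_eq_sum_dirDeriv, ← Finset.sum_add_distrib]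
  refine Finset.sum_congr rfl fun i _ => ?_
  rw [dirDeriv_add hf.differentiable_of_top hg.differentiable_of_top,
    dirDeriv_add (hf.dirDeriv _).differentiable_of_top (hg.dirDeriv _).differentiable_of_top]

theorem lapl_const_mul {f : 𝔼 → ℝ} (hf : ContDiff ℝ (⊤ : ℕ∞) f) (c : ℝ) (x : 𝔼) :
    lapl (fun y => c * f y) x = c * lapl f x := by
  simp only [lapl_eq_sum_dirDeriv, Finset.mul_sum]
  refine Finset.sum_congr rfl fun i _ => ?_
  rw [dirDeriv_const_mul hf.differentiable_of_top,
    dirDeriv_const_mul (hf.dirDeriv _).differentiable_of_top]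

theorem lapl_sum {ι : Type*} {s : Finset ι} {f : ι → 𝔼 → ℝ}
    (hf : ∀ i ∈ s, ContDiff ℝ (⊤ : ℕ∞) (f i)) (x : 𝔼) :
    lapl (fun y => ∑ i ∈ s, f i y) x = ∑ i ∈ s, lapl (f i) x := by
  simp only [lapl_eq_sum_dirDeriv]
  rw [Finset.sum_comm]
  refine Finset.sum_congr rfl fun i _ => ?_
  rw [dirDeriv_sum fun j hj => (hf j hj).differentiable_of_top,
    dirDeriv_sum fun j hj => ((hf j hj).dirDeriv _).differentiable_of_top]

theorem lapl_mul {f g : 𝔼 → ℝ} (hf : ContDiff ℝ (⊤ : ℕ∞) f) (hg : ContDiff ℝ (⊤ : ℕ∞) g) (x : 𝔼) :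
    lapl (fun y => f y * g y) x =
      f x * lapl g x + 2 * ⟪gradient f x, gradient g x⟫ + g x * lapl f x := by
  simp only [inner_gradient_eq_sum, lapl_eq_sum_dirDeriv, Finset.mul_sum, ← Finset.sum_add_distrib]
  refine Finset.sum_congr rfl fun i _ => ?_
  set e : 𝔼 := EuclideanSpace.single i (1 : ℝ)
  have hf' := hf.differentiable_of_top
  have hg' := hg.differentiable_of_top
  have hdf := (hf.dirDeriv e).differentiable_of_top
  have hdg := (hg.dirDeriv e).differentiable_of_top
  rw [dirDeriv_mul hf' hg', dirDeriv_add (hf'.fun_mul hdg) (hg'.fun_mul hdf),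
    dirDeriv_mul hf' hdg, dirDeriv_mul hg' hdf]
  ring

theorem ContDiff.rpow_of_pos {f : 𝔼 → ℝ} (hf : ContDiff ℝ (⊤ : ℕ∞) f) (hpos : ∀ y, 0 < f y)
    (a : ℝ) : ContDiff ℝ (⊤ : ℕ∞) (fun y => f y ^ a) :=
  hf.rpow_const_of_ne fun y => (hpos y).ne'

theorem lapl_rpow {f : 𝔼 → ℝ} (hf : ContDiff ℝ (⊤ : ℕ∞) f) (hpos : ∀ y, 0 < f y) (a : ℝ) (x : 𝔼) :
    lapl (fun y => f y ^ a) x =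
      a * f x ^ (a - 1) * lapl f x + a * (a - 1) * f x ^ (a - 2) * ‖gradient f x‖ ^ 2 := by
  rw [← real_inner_self_eq_norm_sq]
  simp only [inner_gradient_eq_sum, lapl_eq_sum_dirDeriv, Finset.mul_sum, ← Finset.sum_add_distrib]
  refine Finset.sum_congr rfl fun i _ => ?_
  set e : 𝔼 := EuclideanSpace.single i (1 : ℝ)
  have hf' := hf.differentiable_of_top
  have hdf := (hf.dirDeriv e).differentiable_of_top
  have hp := (hf.rpow_of_pos hpos (a - 1)).differentiable_of_top
  rw [dirDeriv_rpow hf' hpos, dirDeriv_const_mul (hp.fun_mul hdf), dirDeriv_mul hp hdf,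
    dirDeriv_rpow hf' hpos, show a - 1 - 1 = a - 2 by ring]
  ring

theorem lapl_dirDeriv {f : 𝔼 → ℝ} (hf : ContDiff ℝ (⊤ : ℕ∞) f) (e x : 𝔼) :
    lapl (dirDeriv e f) x = dirDeriv e (lapl f) x := by
  have hcomm : ∀ {g : 𝔼 → ℝ}, ContDiff ℝ (⊤ : ℕ∞) g → ∀ a b : 𝔼,
      dirDeriv a (dirDeriv b g) = dirDeriv b (dirDeriv a g) := fun hg a b =>
    funext fun z => dirDeriv_comm_of_contDiffAt hg.contDiffAt a b
  simp only [lapl_eq_sum_dirDeriv]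
  rw [dirDeriv_sum fun i _ => ((hf.dirDeriv _).dirDeriv _).differentiable_of_top]
  refine Finset.sum_congr rfl fun i _ => ?_
  rw [hcomm hf, hcomm (hf.dirDeriv _)]

/-- Bochner's identity, with the Hessian term bounded below by Cauchy–Schwarz. -/
theorem lapl_norm_gradient_sq_ge {f : 𝔼 → ℝ} (hf : ContDiff ℝ (⊤ : ℕ∞) f) (hN : 1 ≤ N) (x : 𝔼) :
    2 * ⟪gradient f x, gradient (lapl f) x⟫ + 2 / (N : ℝ) * lapl f x ^ 2 ≤
      lapl (fun y => ‖gradient f y‖ ^ 2) x := by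
  have hN' : (0 : ℝ) < N := by exact_mod_cast hN
  simp only [← real_inner_self_eq_norm_sq, inner_gradient_eq_sum]
  rw [lapl_sum fun i _ => (hf.dirDeriv _).mul (hf.dirDeriv _)]
  simp only [lapl_mul (hf.dirDeriv _) (hf.dirDeriv _), lapl_dirDeriv hf]
  have hcs : lapl f x ^ 2 ≤ N * ∑ i : Fin N, ⟪gradient
      (dirDeriv (EuclideanSpace.single i (1 : ℝ)) f) x, gradient
      (dirDeriv (EuclideanSpace.single i (1 : ℝ)) f) x⟫ := by
    rw [lapl_eq_sum_dirDeriv]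
    refine sq_sum_le_card_mul_sum_sq.trans ?_
    rw [Finset.card_univ, Fintype.card_fin]
    refine mul_le_mul_of_nonneg_left (Finset.sum_le_sum fun i _ => ?_) hN'.le
    rw [inner_gradient_eq_sum, sq]
    exact Finset.single_le_sum (f := fun j : Fin N =>
      dirDeriv (EuclideanSpace.single j (1 : ℝ)) (dirDeriv (EuclideanSpace.single i (1 : ℝ)) f) x *
      dirDeriv (EuclideanSpace.single j (1 : ℝ)) (dirDeriv (EuclideanSpace.single i (1 : ℝ)) f) x)
      (fun j _ => mul_self_nonneg _) (Finset.mem_univ i)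
  have hdiv : 2 / (N : ℝ) * lapl f x ^ 2 ≤ 2 * ∑ i : Fin N, ⟪gradient
      (dirDeriv (EuclideanSpace.single i (1 : ℝ)) f) x, gradient
      (dirDeriv (EuclideanSpace.single i (1 : ℝ)) f) x⟫ := by
    rw [div_mul_eq_mul_div, div_le_iff₀ hN']
    linarith
  refine (add_le_add_right hdiv _).trans (le_of_eq ?_)
  simp only [Finset.mul_sum, ← Finset.sum_add_distrib]
  refine Finset.sum_congr rfl fun i _ => ?_
  ring

theorem lapl_pressure_rhs_ge {f : 𝔼 → ℝ} (hf : ContDiff ℝ (⊤ : ℕ∞) f) (hpos : ∀ y, 0 < f y)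
    (hN : 1 ≤ N) (m K a : ℝ) (x : 𝔼) :
    (m - 1) * f x * lapl (lapl f) x + 2 * m * ⟪gradient f x, gradient (lapl f) x⟫
        + (m - 1 + 2 / (N : ℝ)) * lapl f x ^ 2 + K * a * f x ^ (a - 1) * lapl f x
        + K * (a * (a - 1)) * f x ^ (a - 2) * ‖gradient f x‖ ^ 2 ≤
      lapl (fun y => (m - 1) * f y * lapl f y + ‖gradient f y‖ ^ 2 + K * f y ^ a) x := by
  have hgrad : ContDiff ℝ (⊤ : ℕ∞) (fun y => ‖gradient f y‖ ^ 2) := by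
    simp only [← real_inner_self_eq_norm_sq, inner_gradient_eq_sum]
    exact ContDiff.sum fun i _ => (hf.dirDeriv _).mul (hf.dirDeriv _)
  have hprod : ContDiff ℝ (⊤ : ℕ∞) (fun y => f y * lapl f y) := hf.mul hf.lapl
  have hpow := hf.rpow_of_pos hpos a
  have hB := lapl_norm_gradient_sq_ge hf hN x
  simp only [mul_assoc (m - 1)]
  rw [lapl_add ((contDiff_const.mul hprod).add hgrad) (contDiff_const.mul hpow),
    lapl_add (contDiff_const.mul hprod) hgrad, lapl_const_mul hprod, lapl_const_mul hpow,
    lapl_mul hf hf.lapl, lapl_rpow hf hpos]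
  linarith

end Laplacian

section TimeDerivative

variable {N : ℕ}

local notation "𝔼" => EuclideanSpace ℝ (Fin N)

theorem dirDeriv_slice {G : 𝔼 × ℝ → ℝ} {x : 𝔼} {t : ℝ} (hG : DifferentiableAt ℝ G (x, t)) (e : 𝔼) :
    dirDeriv e (fun y => G (y, t)) x = dirDeriv (e, (0 : ℝ)) G (x, t) := by
  have h := hG.hasFDerivAt.comp x (hasFDerivAt_prodMk_left (𝕜 := ℝ) x t)
  unfold dirDeriv
  rw [show (fun y => G (y, t)) = G ∘ fun y => (y, t) from rfl, h.fderiv]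
  simp

theorem deriv_slice {G : 𝔼 × ℝ → ℝ} {x : 𝔼} {t : ℝ} (hG : DifferentiableAt ℝ G (x, t)) :
    deriv (fun s => G (x, s)) t = dirDeriv ((0 : 𝔼), (1 : ℝ)) G (x, t) := by
  have h := hG.hasFDerivAt.comp t (hasFDerivAt_prodMk_right (𝕜 := ℝ) x t)
  rw [show (fun s => G (x, s)) = G ∘ fun s => (x, s) from rfl, h.hasDerivAt.deriv]
  simp [dirDeriv]

theorem lapl_slice {G : 𝔼 × ℝ → ℝ} {T : ℝ}
    (hG : ContDiffOn ℝ (⊤ : ℕ∞) G (univ ×ˢ Ioo (0 : ℝ) T)) (x : 𝔼) {t : ℝ} (ht : t ∈ Ioo (0 : ℝ) T) :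
    lapl (fun y => G (y, t)) x = ∑ i : Fin N,
      dirDeriv (EuclideanSpace.single i (1 : ℝ), (0 : ℝ))
        (dirDeriv (EuclideanSpace.single i (1 : ℝ), (0 : ℝ)) G) (x, t) := by
  have hU : IsOpen ((univ : Set 𝔼) ×ˢ Ioo (0 : ℝ) T) := isOpen_univ.prod isOpen_Ioo
  rw [lapl_eq_sum_dirDeriv]
  refine Finset.sum_congr rfl fun i _ => ?_
  rw [show dirDeriv (EuclideanSpace.single i (1 : ℝ)) (fun y => G (y, t)) =
      fun y => dirDeriv (EuclideanSpace.single i (1 : ℝ), (0 : ℝ)) G (y, t) from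
    funext fun y => dirDeriv_slice (hG.differentiableAt_of_isOpen hU ⟨mem_univ y, ht⟩) _]
  exact dirDeriv_slice ((hG.dirDeriv hU _).differentiableAt_of_isOpen hU ⟨mem_univ x, ht⟩) _

/-- The Laplacian commutes with the time derivative. -/
theorem deriv_lapl_slice {G : 𝔼 × ℝ → ℝ} {T : ℝ}
    (hG : ContDiffOn ℝ (⊤ : ℕ∞) G (univ ×ˢ Ioo (0 : ℝ) T)) (x : 𝔼) {t : ℝ} (ht : t ∈ Ioo (0 : ℝ) T) :
    deriv (fun s => lapl (fun y => G (y, s)) x) t =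
      lapl (fun y => deriv (fun s => G (y, s)) t) x := by
  have hU : IsOpen ((univ : Set 𝔼) ×ˢ Ioo (0 : ℝ) T) := isOpen_univ.prod isOpen_Ioo
  have hmem : ∀ y : 𝔼, (y, t) ∈ (univ : Set 𝔼) ×ˢ Ioo (0 : ℝ) T := fun y => ⟨mem_univ y, ht⟩
  have hcomm : ∀ {g : 𝔼 × ℝ → ℝ}, ContDiffOn ℝ (⊤ : ℕ∞) g (univ ×ˢ Ioo (0 : ℝ) T) →
      ∀ a b : 𝔼 × ℝ,
        EqOn (dirDeriv a (dirDeriv b g)) (dirDeriv b (dirDeriv a g)) (univ ×ˢ Ioo (0 : ℝ) T) :=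
    fun hg a b z hz => dirDeriv_comm_of_contDiffAt (hg.contDiffAt (hU.mem_nhds hz)) a b
  have hslice : (fun y => deriv (fun s => G (y, s)) t) =
      fun y => dirDeriv ((0 : 𝔼), (1 : ℝ)) G (y, t) :=
    funext fun y => deriv_slice (hG.differentiableAt_of_isOpen hU (hmem y))
  have hlapl : (fun s => lapl (fun y => G (y, s)) x) =ᶠ[nhds t] fun s => ∑ i : Fin N,
      dirDeriv (EuclideanSpace.single i (1 : ℝ), (0 : ℝ))
        (dirDeriv (EuclideanSpace.single i (1 : ℝ), (0 : ℝ)) G) (x, s) := by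
    filter_upwards [isOpen_Ioo.mem_nhds ht] with s hs
    exact lapl_slice hG x hs
  have hdiff : ∀ i : Fin N, DifferentiableAt ℝ
      (dirDeriv (EuclideanSpace.single i (1 : ℝ), (0 : ℝ))
        (dirDeriv (EuclideanSpace.single i (1 : ℝ), (0 : ℝ)) G)) (x, t) := fun i =>
    ((hG.dirDeriv hU _).dirDeriv hU _).differentiableAt_of_isOpen hU (hmem x)
  rw [hslice, lapl_slice (hG.dirDeriv hU _) x ht, hlapl.deriv_eq,
    deriv_fun_sum fun i _ => (hdiff i).fun_comp' t
      ((differentiableAt_const x).prodMk differentiableAt_id)]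
  refine Finset.sum_congr rfl fun i _ => ?_
  rw [deriv_slice (hdiff i), hcomm (hG.dirDeriv hU _) _ _ (hmem x)]
  exact dirDeriv_congr_of_eqOn hU (hcomm hG _ _) _ (hmem x)

end TimeDerivative

/-- The equation/inequality satisfied by w = Δv when v solves the pressure equation,
m + p < 2, together with the signs of R₁ and R₂. -/
theorem laplacian_pressure_inequality
    {N : ℕ} (hN : 1 ≤ N) {m p T K : ℝ} (hm : 1 < m) (hp0 : 0 < p) (hp1 : p < 1)
    (hmp : m + p < 2)
    (hK : K = m * ((m - 1) / m) ^ ((m + p - 2) / (m - 1)))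
    (v : EuclideanSpace ℝ (Fin N) → ℝ → ℝ)
    (hvpos : ∀ x : EuclideanSpace ℝ (Fin N), ∀ t ∈ Ioo (0:ℝ) T, 0 < v x t)
    (hvreg : ContDiffOn ℝ (⊤ : ℕ∞) (Function.uncurry v) (univ ×ˢ Ioo (0:ℝ) T))
    (hveq : ∀ x : EuclideanSpace ℝ (Fin N), ∀ t ∈ Ioo (0:ℝ) T,
      deriv (v x) t =
        (m - 1) * v x t * lapl (fun y => v y t) x
        + ‖gradient (fun y => v y t) x‖ ^ 2
        + K * v x t ^ ((m + p - 2) / (m - 1)))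
    (w : EuclideanSpace ℝ (Fin N) → ℝ → ℝ)
    (hw : ∀ x t, w x t = lapl (fun y => v y t) x) :
    ∀ x : EuclideanSpace ℝ (Fin N), ∀ t ∈ Ioo (0:ℝ) T,
      ((m - 1) * v x t * lapl (fun y => w y t) x
        + 2 * m * ⟪gradient (fun y => v y t) x, gradient (fun y => w y t) x⟫
        + (m - 1 + 2 / (N : ℝ)) * w x t ^ 2
        + (K * ((m + p - 2) / (m - 1)) * v x t ^ ((p - 1) / (m - 1))) * w x t
        + K * ((2 - m - p) * (1 - p) / (m - 1) ^ 2) * v x t ^ ((p - m) / (m - 1))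
            * ‖gradient (fun y => v y t) x‖ ^ 2
        ≤ deriv (w x) t)
      ∧ K * ((m + p - 2) / (m - 1)) * v x t ^ ((p - 1) / (m - 1)) < 0
      ∧ 0 ≤ K * ((2 - m - p) * (1 - p) / (m - 1) ^ 2) * v x t ^ ((p - m) / (m - 1))
            * ‖gradient (fun y => v y t) x‖ ^ 2 := by
  intro x t ht
  have hm1 : 0 < m - 1 := by linarith
  have hKpos : 0 < K := by
    rw [hK]
    exact mul_pos (by linarith) (Real.rpow_pos_of_pos (div_pos hm1 (by linarith)) _)
  refine ⟨?_, ?_, ?_⟩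
  · have hf : ContDiff ℝ (⊤ : ℕ∞) (fun y => v y t) :=
      contDiffOn_univ.1 (hvreg.comp (contDiff_id.prodMk contDiff_const).contDiffOn
        fun y _ => ⟨mem_univ y, ht⟩)
    have hwt : deriv (w x) t = lapl (fun y => deriv (v y) t) x := by
      rw [show w x = fun s => lapl (fun y => v y s) x from funext fun s => hw x s]
      exact deriv_lapl_slice hvreg x ht
    have key := lapl_pressure_rhs_ge hf (fun y => hvpos y t ht) hN m K
      ((m + p - 2) / (m - 1)) x
    rw [show (m + p - 2) / (m - 1) - 1 = (p - 1) / (m - 1) by field_simp; ring,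
      show (m + p - 2) / (m - 1) - 2 = (p - m) / (m - 1) by field_simp; ring,
      show (m + p - 2) / (m - 1) * ((p - 1) / (m - 1)) =
        (2 - m - p) * (1 - p) / (m - 1) ^ 2 by field_simp; ring] at key
    rw [hwt, show (fun y => w y t) = lapl (fun y => v y t) from funext fun y => hw y t, hw x t,
      show (fun y => deriv (v y) t) = _ from funext fun y => hveq y t ht]
    exact key
  · exact mul_neg_of_neg_of_pos
      (mul_neg_of_pos_of_neg hKpos (div_neg_of_neg_of_pos (by linarith) hm1))
      (Real.rpow_pos_of_pos (hvpos x t ht) _)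
  · have h1 : 0 ≤ (2 - m - p) * (1 - p) :=
      mul_nonneg (by linarith) (by linarith)
    have h2 := Real.rpow_pos_of_pos (hvpos x t ht) ((p - m) / (m - 1))
    positivity
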